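/- Let A be an approximately amenable Banach algebra and let J be a closed two-sided ideal in A possessing a bounded right approximate identity. Then J has a left approximate identity (not necessarily bounded). -/

import Mathlib

open scoped TensorProduct ENNReal
open MeasureTheory Filter

noncomputable section

/-- The projective tensor norm of an element of the algebraic tensor product `A ⊗[ℂ] A`;
the projective tensor product `A ⊗̂ A` is the completion of `A ⊗[ℂ] A` in this norm, and a
net in `A ⊗̂ A` witnessing an approximate diagonal may always be taken in the dense
subspace `A ⊗[ℂ] A`. -/
def projNorm {A : Type*} [NonUnitalNormedRing A] [NormedSpace ℂ A]
    (u : TensorProduct ℂ A A) : ℝ :=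
  sInf { r : ℝ | ∃ l : List (A × A), u = (l.map fun p => p.1 ⊗ₜ[ℂ] p.2).sum ∧
      r = (l.map fun p => ‖p.1‖ * ‖p.2‖).sum }

/-- The left `A`-bimodule action on `A ⊗ A`: `a • (x ⊗ y) = (a*x) ⊗ y`. -/
def diagL {A : Type*} [NonUnitalNormedRing A] [NormedSpace ℂ A]
    [SMulCommClass ℂ A A] [IsScalarTower ℂ A A]
    (a : A) (u : TensorProduct ℂ A A) : TensorProduct ℂ A A :=
  TensorProduct.map (LinearMap.mulLeft ℂ a) LinearMap.id u

/-- The right `A`-bimodule action on `A ⊗ A`: `(x ⊗ y) • a = x ⊗ (y*a)`. -/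
def diagR {A : Type*} [NonUnitalNormedRing A] [NormedSpace ℂ A]
    [SMulCommClass ℂ A A] [IsScalarTower ℂ A A]
    (a : A) (u : TensorProduct ℂ A A) : TensorProduct ℂ A A :=
  TensorProduct.map LinearMap.id (LinearMap.mulRight ℂ a) u

/-- The multiplication map `π : A ⊗ A → A`, `π(x ⊗ y) = x*y`. -/
def tensMul {A : Type*} [NonUnitalNormedRing A] [NormedSpace ℂ A]
    [SMulCommClass ℂ A A] [IsScalarTower ℂ A A] :
    TensorProduct ℂ A A →ₗ[ℂ] A :=
  TensorProduct.lift (LinearMap.mul ℂ A)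

/-- `A` has a (not necessarily bounded) approximate diagonal: a net `(d_α)` in `A ⊗̂ A`
with `‖a·d_α − d_α·a‖ → 0` and `‖a π(d_α) − a‖ → 0` for every `a ∈ A`.  This is formulated
via the equivalent cofinal finite-set/ε criterion (the net is then indexed by pairs
`(S, ε)` ordered by inclusion/refinement). -/
def HasApproxDiagonal (A : Type*) [NonUnitalNormedRing A] [NormedSpace ℂ A]
    [SMulCommClass ℂ A A] [IsScalarTower ℂ A A] : Prop :=
  ∀ (S : Finset A) (ε : ℝ), 0 < ε → ∃ u : TensorProduct ℂ A A,
    ∀ a ∈ S, projNorm (diagL a u - diagR a u) < ε ∧ ‖a * tensMul u - a‖ < ε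

/-- `A` is amenable: it has a bounded approximate diagonal. -/
def IsAmenable (A : Type*) [NonUnitalNormedRing A] [NormedSpace ℂ A]
    [SMulCommClass ℂ A A] [IsScalarTower ℂ A A] : Prop :=
  ∃ C : ℝ, ∀ (S : Finset A) (ε : ℝ), 0 < ε → ∃ u : TensorProduct ℂ A A,
    projNorm u ≤ C ∧
    ∀ a ∈ S, projNorm (diagL a u - diagR a u) < ε ∧ ‖a * tensMul u - a‖ < ε

/-- `A` is approximately amenable: its forced unitization `A# = ℂ ⊕ A` (equipped with the
ℓ¹ norm `‖(λ, a)‖ = ‖λ‖ + ‖a‖`) has a, not necessarily bounded, approximate diagonal. -/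
def IsApproxAmenable (A : Type*) [NonUnitalNormedRing A] [NormedSpace ℂ A]
    [SMulCommClass ℂ A A] [IsScalarTower ℂ A A] : Prop :=
  HasApproxDiagonal (WithLp 1 (Unitization ℂ A))

/-- A subset `J` of a normed algebra has a bounded right approximate identity: a norm-bounded
net `(e_α)` in `J` with `‖x - x * e_α‖ → 0` for every `x ∈ J` (equivalently, formulated via
the cofinal finite-set/ε criterion). -/
def HasBoundedRightApproxId {A : Type*} [NonUnitalNormedRing A] (J : Set A) : Prop :=
  ∃ C : ℝ, ∀ (F : Finset A), (∀ x ∈ F, x ∈ J) → ∀ ε : ℝ, 0 < ε →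
    ∃ e ∈ J, ‖e‖ ≤ C ∧ ∀ x ∈ F, ‖x - x * e‖ < ε

/-- A subset `J` of a normed algebra has a bounded left approximate identity: a norm-bounded
net `(e_α)` in `J` with `‖x - e_α * x‖ → 0` for every `x ∈ J`. -/
def HasBoundedLeftApproxId {A : Type*} [NonUnitalNormedRing A] (J : Set A) : Prop :=
  ∃ C : ℝ, ∀ (F : Finset A), (∀ x ∈ F, x ∈ J) → ∀ ε : ℝ, 0 < ε →
    ∃ e ∈ J, ‖e‖ ≤ C ∧ ∀ x ∈ F, ‖x - e * x‖ < ε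

/-- A subset `J` of a normed algebra has a (not necessarily bounded) left approximate
identity: a net `(v_β)` in `J` with `‖x - v_β * x‖ → 0` for every `x ∈ J`. -/
def HasLeftApproxId {A : Type*} [NonUnitalNormedRing A] (J : Set A) : Prop :=
  ∀ (F : Finset A), (∀ x ∈ F, x ∈ J) → ∀ ε : ℝ, 0 < ε →
    ∃ v ∈ J, ∀ x ∈ F, ‖x - v * x‖ < ε

section ApproxDiagonal

variable {B : Type*} [NonUnitalNormedRing B] [NormedSpace ℂ B]

theorem exists_list_sum_tmul (u : B ⊗[ℂ] B) :
    ∃ l : List (B × B), u = (l.map fun p => p.1 ⊗ₜ[ℂ] p.2).sum := by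
  induction u using TensorProduct.induction_on with
  | zero => exact ⟨[], by simp⟩
  | tmul a b => exact ⟨[(a, b)], by simp⟩
  | add u v hu hv =>
    obtain ⟨l, rfl⟩ := hu
    obtain ⟨m, rfl⟩ := hv
    exact ⟨l ++ m, by simp⟩

theorem exists_list_of_projNorm_lt {u : B ⊗[ℂ] B} {r : ℝ} (h : projNorm u < r) :
    ∃ l : List (B × B), u = (l.map fun p => p.1 ⊗ₜ[ℂ] p.2).sum ∧
      (l.map fun p => ‖p.1‖ * ‖p.2‖).sum < r := by
  obtain ⟨l, hl⟩ := exists_list_sum_tmul u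
  obtain ⟨_, ⟨m, hm, rfl⟩, hlt⟩ := exists_lt_of_csInf_lt (by exact ⟨_, l, hl, rfl⟩) h
  exact ⟨m, hm, hlt⟩

variable [SMulCommClass ℂ B B] [IsScalarTower ℂ B B]

/-- The linear map `B ⊗ B → B` given by `x ⊗ y ↦ x * e * y`. -/
def sandwich (e : B) : B ⊗[ℂ] B →ₗ[ℂ] B :=
  tensMul ∘ₗ TensorProduct.map (LinearMap.mulRight ℂ e) LinearMap.id

@[simp]
theorem tensMul_tmul (a b : B) : tensMul (a ⊗ₜ[ℂ] b) = a * b := by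
  simp [tensMul]

@[simp]
theorem sandwich_tmul (e a b : B) : sandwich e (a ⊗ₜ[ℂ] b) = a * e * b := by
  simp [sandwich]

theorem sandwich_diagL (e a : B) (u : B ⊗[ℂ] B) :
    sandwich e (diagL a u) = a * sandwich e u := by
  induction u using TensorProduct.induction_on with
  | zero => simp [diagL]
  | tmul x y => simp [diagL, mul_assoc]
  | add u v hu hv =>
    simp only [diagL, map_add, mul_add] at hu hv ⊢
    rw [hu, hv]

theorem sandwich_diagR (e a : B) (u : B ⊗[ℂ] B) :
    sandwich e (diagR a u) = sandwich e u * a := by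
  induction u using TensorProduct.induction_on with
  | zero => simp [diagR]
  | tmul x y => simp [diagR, mul_assoc]
  | add u v hu hv =>
    simp only [diagR, map_add, add_mul] at hu hv ⊢
    rw [hu, hv]

theorem norm_sandwich_lt {e : B} {C r : ℝ} (he : ‖e‖ ≤ C) (hC : 0 < C) {u : B ⊗[ℂ] B}
    (hu : projNorm u < r) : ‖sandwich e u‖ < C * r := by
  obtain ⟨l, rfl, hl⟩ := exists_list_of_projNorm_lt hu
  refine lt_of_le_of_lt ?_ (mul_lt_mul_of_pos_left hl hC)
  clear hl hu
  induction l with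
  | nil => simp
  | cons p l ih =>
    simp only [List.map_cons, List.sum_cons, map_add, sandwich_tmul, mul_add]
    refine (norm_add_le _ _).trans (add_le_add ?_ ih)
    calc ‖p.1 * e * p.2‖ ≤ ‖p.1‖ * ‖e‖ * ‖p.2‖ := norm_mul₃_le
      _ ≤ ‖p.1‖ * C * ‖p.2‖ := by gcongr
      _ = C * (‖p.1‖ * ‖p.2‖) := by ring

theorem sandwich_mem {J : Submodule ℂ B} (hr : ∀ a ∈ J, ∀ b : B, a * b ∈ J)
    (hl : ∀ a ∈ J, ∀ b : B, b * a ∈ J) {e : B} (he : e ∈ J) (u : B ⊗[ℂ] B) :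
    sandwich e u ∈ J := by
  induction u using TensorProduct.induction_on with
  | zero => simp
  | tmul x y => simpa using hr _ (hl e he x) y
  | add u v hu hv => simpa using J.add_mem hu hv

theorem norm_mul_tensMul_sub_mul_sandwich_le {e x : B} {δ : ℝ} (l : List (B × B))
    (h : ∀ p ∈ l, ‖x * p.1 - x * p.1 * e‖ ≤ δ) :
    ‖x * tensMul (l.map fun p => p.1 ⊗ₜ[ℂ] p.2).sum -
      x * sandwich e (l.map fun p => p.1 ⊗ₜ[ℂ] p.2).sum‖ ≤ δ * (l.map fun p => ‖p.2‖).sum := by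
  induction l with
  | nil => simp
  | cons p l ih =>
    simp only [List.map_cons, List.sum_cons, map_add, tensMul_tmul, sandwich_tmul, mul_add]
    rw [add_sub_add_comm]
    refine (norm_add_le _ _).trans (add_le_add ?_ (ih fun q hq => h q (by simp [hq])))
    calc ‖x * (p.1 * p.2) - x * (p.1 * e * p.2)‖ = ‖(x * p.1 - x * p.1 * e) * p.2‖ := by
          simp only [sub_mul, mul_assoc]
      _ ≤ ‖x * p.1 - x * p.1 * e‖ * ‖p.2‖ := norm_mul_le _ _
      _ ≤ δ * ‖p.2‖ := by gcongr; exact h p (by simp)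

open Classical in
theorem HasApproxDiagonal.hasLeftApproxId (hB : HasApproxDiagonal B) {J : Submodule ℂ B}
    (hr : ∀ a ∈ J, ∀ b : B, a * b ∈ J) (hl : ∀ a ∈ J, ∀ b : B, b * a ∈ J)
    (hJ : HasBoundedRightApproxId (J : Set B)) : HasLeftApproxId (J : Set B) := by
  intro F hF ε hε
  obtain ⟨C, hC⟩ := hJ
  have hD : 0 < max C 1 := by positivity
  obtain ⟨u, hu⟩ := hB F (ε / (3 * max C 1)) (by positivity)
  obtain ⟨l, rfl⟩ := exists_list_sum_tmul u
  have hN : 0 ≤ (l.map fun p : B × B => ‖p.2‖).sum :=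
    List.sum_nonneg (List.forall_mem_map.2 fun p _ => norm_nonneg p.2)
  set N := (l.map fun p : B × B => ‖p.2‖).sum
  set u := (l.map fun p : B × B => p.1 ⊗ₜ[ℂ] p.2).sum
  obtain ⟨e, heJ, heC, he⟩ := hC ((F ×ˢ l.toFinset).image fun q => q.1 * q.2.1)
    (by
      intro y hy
      obtain ⟨q, hq, rfl⟩ := Finset.mem_image.1 hy
      exact hr _ (hF _ (Finset.mem_product.1 hq).1) _)
    (ε / (3 * (N + 1))) (by positivity)
  refine ⟨sandwich e u, sandwich_mem hr hl heJ u, fun x hx => ?_⟩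
  have h₁ : ‖x - x * tensMul u‖ < ε / 3 := by
    rw [norm_sub_rev]
    refine (hu x hx).2.trans_le ?_
    gcongr
    linarith [le_max_right C 1]
  have h₂ : ‖x * tensMul u - x * sandwich e u‖ ≤ ε / 3 := by
    refine (norm_mul_tensMul_sub_mul_sandwich_le l fun p hp => (he (x * p.1)
      (Finset.mem_image.2 ⟨(x, p), by simp [hx, hp], rfl⟩)).le).trans ?_
    change ε / (3 * (N + 1)) * N ≤ ε / 3
    rw [div_mul_eq_mul_div, div_le_div_iff₀ (by positivity) (by positivity)]
    nlinarith
  have h₃ : ‖x * sandwich e u - sandwich e u * x‖ < ε / 3 := by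
    rw [← sandwich_diagL, ← sandwich_diagR, ← map_sub]
    refine (norm_sandwich_lt (heC.trans (le_max_left C 1)) hD (hu x hx).1).trans_eq ?_
    field_simp
  calc ‖x - sandwich e u * x‖
      = ‖(x - x * tensMul u) + (x * tensMul u - x * sandwich e u) +
          (x * sandwich e u - sandwich e u * x)‖ := by congr 1; abel
    _ ≤ ‖x - x * tensMul u‖ + ‖x * tensMul u - x * sandwich e u‖ +
          ‖x * sandwich e u - sandwich e u * x‖ := norm_add₃_le
    _ < ε := by linarith

end ApproxDiagonal

section Unitization

variable {A : Type*} [NonUnitalNormedRing A] [NormedSpace ℂ A]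

/-- The isometric embedding of `A` into its unitization with the `ℓ¹` norm. -/
def inrL1 : A →ₗ[ℂ] WithLp 1 (Unitization ℂ A) :=
  (WithLp.linearEquiv 1 ℂ (Unitization ℂ A)).symm.toLinearMap ∘ₗ Unitization.inrHom ℂ ℂ A

theorem norm_inrL1 (a : A) : ‖inrL1 a‖ = ‖a‖ :=
  WithLp.unitization_norm_inr a

variable [SMulCommClass ℂ A A] [IsScalarTower ℂ A A]

theorem inrL1_mul (a b : A) : inrL1 (a * b) = inrL1 a * inrL1 b :=
  congrArg (WithLp.toLp 1) (Unitization.inr_mul ℂ a b)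

theorem inrL1_mul_eq (a : A) (b : WithLp 1 (Unitization ℂ A)) :
    inrL1 a * b = inrL1 (b.ofLp.fst • a + a * b.ofLp.snd) := by
  apply WithLp.ofLp_injective
  apply Unitization.ext <;> simp [inrL1]

theorem mul_inrL1_eq (a : A) (b : WithLp 1 (Unitization ℂ A)) :
    b * inrL1 a = inrL1 (b.ofLp.fst • a + b.ofLp.snd * a) := by
  apply WithLp.ofLp_injective
  apply Unitization.ext <;> simp [inrL1]

open Classical in
theorem HasBoundedRightApproxId.map_inrL1 {J : Submodule ℂ A}
    (hJ : HasBoundedRightApproxId (J : Set A)) :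
    HasBoundedRightApproxId (J.map inrL1 : Set (WithLp 1 (Unitization ℂ A))) := by
  obtain ⟨C, hC⟩ := hJ
  refine ⟨C, fun F hF ε hε => ?_⟩
  have hsnd : ∀ a : A, (inrL1 a).ofLp.snd = a := fun a => Unitization.snd_inr ℂ a
  obtain ⟨e, heJ, heC, he⟩ := hC (F.image fun b => b.ofLp.snd)
    (by
      intro y hy
      obtain ⟨b, hb, rfl⟩ := Finset.mem_image.1 hy
      obtain ⟨a, ha, rfl⟩ := hF b hb
      rwa [hsnd]) ε hε
  refine ⟨inrL1 e, ⟨e, heJ, rfl⟩, (norm_inrL1 e).trans_le heC, fun b hb => ?_⟩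
  obtain ⟨a, -, rfl⟩ := hF b hb
  rw [← inrL1_mul, ← map_sub, norm_inrL1]
  exact he a (Finset.mem_image.2 ⟨_, hb, hsnd a⟩)

open Classical in
theorem HasLeftApproxId.of_map_inrL1 {J : Submodule ℂ A}
    (hJ : HasLeftApproxId (J.map inrL1 : Set (WithLp 1 (Unitization ℂ A)))) :
    HasLeftApproxId (J : Set A) := by
  intro F hF ε hε
  obtain ⟨_, ⟨v, hv, rfl⟩, h⟩ := hJ (F.image inrL1)
    (by
      intro y hy
      obtain ⟨a, ha, rfl⟩ := Finset.mem_image.1 hy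
      exact ⟨a, hF a ha, rfl⟩) ε hε
  refine ⟨v, hv, fun a ha => ?_⟩
  rw [← norm_inrL1, map_sub, inrL1_mul]
  exact h _ (Finset.mem_image_of_mem _ ha)

end Unitization

/-- If `A` is an approximately amenable Banach algebra and `J` is a closed two-sided ideal
of `A` with a bounded right approximate identity, then `J` has a (not necessarily bounded)
left approximate identity. -/
theorem closed_ideal_of_approximately_amenable_has_lai
    {A : Type*} [NonUnitalNormedRing A] [NormedSpace ℂ A]
    [SMulCommClass ℂ A A] [IsScalarTower ℂ A A] [CompleteSpace A]
    (hA : IsApproxAmenable A)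
    (J : Submodule ℂ A) (hJclosed : IsClosed (J : Set A))
    (hJmul_right : ∀ a ∈ J, ∀ b : A, a * b ∈ J)
    (hJmul_left : ∀ a ∈ J, ∀ b : A, b * a ∈ J)
    (hRAI : HasBoundedRightApproxId (J : Set A)) :
    HasLeftApproxId (J : Set A) := by
  refine .of_map_inrL1 (HasApproxDiagonal.hasLeftApproxId hA ?_ ?_ hRAI.map_inrL1)
  · rintro _ ⟨a, ha, rfl⟩ b
    exact inrL1_mul_eq a b ▸
      ⟨_, J.add_mem (J.smul_mem _ ha) (hJmul_right a ha _), rfl⟩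
  · rintro _ ⟨a, ha, rfl⟩ b
    exact mul_inrL1_eq a b ▸
      ⟨_, J.add_mem (J.smul_mem _ ha) (hJmul_left a ha _), rfl⟩
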